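/- arXiv:math-ph/0104008 — 2 statements merged into one kernel-verified Lean document; each statement's English description precedes it below -/
import Mathlib

section
/- Let Ω ⊆ ℝ³ be open, ω ∈ ℂ, and let ε, μ : Ω → ℂ be nowhere-vanishing functions admitting differentiable nowhere-vanishing square roots s, m : Ω → ℂ (s² = ε, m² = μ). Let E, H : Ω → ℂ³ be differentiable, ρ : Ω → ℂ, j : Ω → ℂ³. Set ℰ = sE, ℋ = mH, k = ω s m, and let ε⃗ = (grad s)/s and μ⃗ = (grad m)/m, regarded as pure complex quaternions. Then the time-harmonic Maxwell system div(εE) = ρ, div(μH) = 0, rot H = iωεE + j, rot E = -iωμH holds on Ω if and only if the quaternionic system Dℰ + ℰ·ε⃗ = -ikℋ - ρ/s and Dℋ + ℋ·μ⃗ = ikℰ + m j holds on Ω, where ℰ, ℋ are regarded as purely imaginary ℍ(ℂ)-valued functions and ℰ·ε⃗, ℋ·μ⃗ denote quaternionic multiplication from the right. -/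
noncomputable section

/-- Partial derivative `∂ₖ` of a complex-valued function on `ℝ³`. -/
def pd (k : Fin 3) (g : (Fin 3 → ℝ) → ℂ) (x : Fin 3 → ℝ) : ℂ :=
  fderiv ℝ g x (Pi.single k 1)

/-- Embedding of a vector in `ℂ³` as a pure (vector-part) complex quaternion
`v₁i₁ + v₂i₂ + v₃i₃`. -/
def vecQ (v : Fin 3 → ℂ) : Quaternion ℂ := ⟨0, v 0, v 1, v 2⟩

/-- Componentwise partial derivative of an `ℍ(ℂ)`-valued function. -/
def pdQ (k : Fin 3) (f : (Fin 3 → ℝ) → Quaternion ℂ) (x : Fin 3 → ℝ) : Quaternion ℂ :=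
  ⟨pd k (fun y => (f y).re) x, pd k (fun y => (f y).imI) x,
   pd k (fun y => (f y).imJ) x, pd k (fun y => (f y).imK) x⟩

/-- The Moisil–Theodoresco operator `Df = i₁∂₁f + i₂∂₂f + i₃∂₃f`. -/
def Dq (f : (Fin 3 → ℝ) → Quaternion ℂ) (x : Fin 3 → ℝ) : Quaternion ℂ :=
  vecQ ![1,0,0] * pdQ 0 f x + vecQ ![0,1,0] * pdQ 1 f x + vecQ ![0,0,1] * pdQ 2 f x

/-- Differentiability at a point of an `ℍ(ℂ)`-valued function (componentwise). -/
def QDiffAt (f : (Fin 3 → ℝ) → Quaternion ℂ) (x : Fin 3 → ℝ) : Prop :=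
  DifferentiableAt ℝ (fun y => (f y).re) x ∧ DifferentiableAt ℝ (fun y => (f y).imI) x ∧
  DifferentiableAt ℝ (fun y => (f y).imJ) x ∧ DifferentiableAt ℝ (fun y => (f y).imK) x

/-- Differentiability at a point of a `ℂ³`-valued function (componentwise). -/
def VDiffAt (g : (Fin 3 → ℝ) → Fin 3 → ℂ) (x : Fin 3 → ℝ) : Prop :=
  ∀ k : Fin 3, DifferentiableAt ℝ (fun y => g y k) x

/-- Divergence of a `ℂ³`-valued function. -/
def divg (g : (Fin 3 → ℝ) → Fin 3 → ℂ) (x : Fin 3 → ℝ) : ℂ :=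
  ∑ k : Fin 3, pd k (fun y => g y k) x

/-- Gradient of a `ℂ`-valued function. -/
def gradg (h : (Fin 3 → ℝ) → ℂ) (x : Fin 3 → ℝ) : Fin 3 → ℂ := fun k => pd k h x

/-- Curl (rotor) of a `ℂ³`-valued function. -/
def rotg (g : (Fin 3 → ℝ) → Fin 3 → ℂ) (x : Fin 3 → ℝ) : Fin 3 → ℂ :=
  ![pd 1 (fun y => g y 2) x - pd 2 (fun y => g y 1) x,
    pd 2 (fun y => g y 0) x - pd 0 (fun y => g y 2) x,
    pd 0 (fun y => g y 1) x - pd 1 (fun y => g y 0) x]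

/-- Complex-bilinear scalar product on `ℂ³`. -/
def dotC (p q : Fin 3 → ℂ) : ℂ := ∑ k : Fin 3, p k * q k

/-- Cross product on `ℂ³`. -/
def crossC (p q : Fin 3 → ℂ) : Fin 3 → ℂ :=
  ![p 1 * q 2 - p 2 * q 1, p 2 * q 0 - p 0 * q 2, p 0 * q 1 - p 1 * q 0]

/-- Laplacian of a `ℂ`-valued function. -/
def lap (h : (Fin 3 → ℝ) → ℂ) (x : Fin 3 → ℝ) : ℂ :=
  ∑ k : Fin 3, pd k (fun y => pd k h y) x

@[simp] theorem re_vecQ (v : Fin 3 → ℂ) : (vecQ v).re = 0 := rfl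

@[simp] theorem imI_vecQ (v : Fin 3 → ℂ) : (vecQ v).imI = v 0 := rfl

@[simp] theorem imJ_vecQ (v : Fin 3 → ℂ) : (vecQ v).imJ = v 1 := rfl

@[simp] theorem imK_vecQ (v : Fin 3 → ℂ) : (vecQ v).imK = v 2 := rfl

@[simp] theorem re_pdQ (k : Fin 3) (f : (Fin 3 → ℝ) → Quaternion ℂ) (x : Fin 3 → ℝ) :
    (pdQ k f x).re = pd k (fun y => (f y).re) x := rfl

@[simp] theorem imI_pdQ (k : Fin 3) (f : (Fin 3 → ℝ) → Quaternion ℂ) (x : Fin 3 → ℝ) :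
    (pdQ k f x).imI = pd k (fun y => (f y).imI) x := rfl

@[simp] theorem imJ_pdQ (k : Fin 3) (f : (Fin 3 → ℝ) → Quaternion ℂ) (x : Fin 3 → ℝ) :
    (pdQ k f x).imJ = pd k (fun y => (f y).imJ) x := rfl

@[simp] theorem imK_pdQ (k : Fin 3) (f : (Fin 3 → ℝ) → Quaternion ℂ) (x : Fin 3 → ℝ) :
    (pdQ k f x).imK = pd k (fun y => (f y).imK) x := rfl

theorem pd_mul (k : Fin 3) {f g : (Fin 3 → ℝ) → ℂ} {x : Fin 3 → ℝ}
    (hf : DifferentiableAt ℝ f x) (hg : DifferentiableAt ℝ g x) :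
    pd k (fun y => f y * g y) x = f x * pd k g x + pd k f x * g x := by
  simp only [pd, fderiv_fun_mul hf hg, add_apply,
    smul_apply, smul_eq_mul]
  ring

theorem pd_zero (k : Fin 3) (x : Fin 3 → ℝ) : pd k (fun _ => 0) x = 0 := by
  simp [pd]

theorem pd_congr (k : Fin 3) {f g : (Fin 3 → ℝ) → ℂ} {x : Fin 3 → ℝ}
    (h : f =ᶠ[nhds x] g) : pd k f x = pd k g x := by
  rw [pd, pd, h.fderiv_eq]

/-- If `f ^ 2 = g` near `x`, then `div (g F) = f (f div F + 2 grad f · F)`. -/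
theorem divg_mul_of_sq_eq {f g : (Fin 3 → ℝ) → ℂ} {F : (Fin 3 → ℝ) → Fin 3 → ℂ}
    {x : Fin 3 → ℝ} (hfg : ∀ᶠ y in nhds x, f y ^ 2 = g y)
    (hf : DifferentiableAt ℝ f x) (hF : VDiffAt F x) :
    divg (fun y k => g y * F y k) x = f x * (f x * divg F x + 2 * dotC (gradg f x) (F x)) := by
  have key (k : Fin 3) : pd k (fun y => g y * F y k) x
      = f x * (f x * pd k (fun y => F y k) x + 2 * (pd k f x * F x k)) := by
    have h : (fun y => g y * F y k) =ᶠ[nhds x] fun y => f y * (f y * F y k) := by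
      filter_upwards [hfg] with y hy
      rw [← hy]
      ring
    rw [pd_congr k h, pd_mul k hf (hf.fun_mul (hF k)), pd_mul k hf (hF k)]
    ring
  simp only [divg, dotC, gradg, Fin.sum_univ_three, key]
  ring

/-- The scalar part of `D (f F) + (f F) · (grad f / f)` is `-(f div F + 2 grad f · F)` and its
vector part is `f rot F`. -/
theorem Dq_vecQ_add_mul_grad {f : (Fin 3 → ℝ) → ℂ} {F : (Fin 3 → ℝ) → Fin 3 → ℂ}
    {x : Fin 3 → ℝ} (hf0 : f x ≠ 0) (hf : DifferentiableAt ℝ f x) (hF : VDiffAt F x) :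
    Dq (fun y => vecQ (fun k => f y * F y k)) x
        + vecQ (fun k => f x * F x k) * vecQ (fun k => pd k f x / f x)
      = ((-(f x * divg F x + 2 * dotC (gradg f x) (F x)) : ℂ) : Quaternion ℂ)
        + vecQ (fun k => f x * rotg F x k) := by
  ext <;>
  · simp [Dq, divg, dotC, gradg, rotg, Fin.sum_univ_three, pd_zero,
      pd_mul _ hf (hF _)]
    field_simp
    ring

/-- Quaternionic reformulation of the time-harmonic Maxwell system for inhomogeneous media:
with `ℰ = sE`, `ℋ = mH`, `k = ωsm`, `ε⃗ = (grad s)/s`, `μ⃗ = (grad m)/m` (`s² = ε`, `m² = μ`),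
the Maxwell equations hold on `Ω` iff
`Dℰ + ℰ·ε⃗ = -ikℋ - ρ/s` and `Dℋ + ℋ·μ⃗ = ikℰ + mj` hold on `Ω`. -/
theorem maxwell_quaternionic_reformulation
    (Ω : Set (Fin 3 → ℝ)) (hΩ : IsOpen Ω) (ω : ℂ)
    (ε μ s m : (Fin 3 → ℝ) → ℂ) (E H : (Fin 3 → ℝ) → Fin 3 → ℂ)
    (ρ : (Fin 3 → ℝ) → ℂ) (j : (Fin 3 → ℝ) → Fin 3 → ℂ)
    (hε0 : ∀ x ∈ Ω, ε x ≠ 0) (hμ0 : ∀ x ∈ Ω, μ x ≠ 0)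
    (hs : ∀ x ∈ Ω, DifferentiableAt ℝ s x) (hm : ∀ x ∈ Ω, DifferentiableAt ℝ m x)
    (hs0 : ∀ x ∈ Ω, s x ≠ 0) (hm0 : ∀ x ∈ Ω, m x ≠ 0)
    (hsε : ∀ x ∈ Ω, s x ^ 2 = ε x) (hmμ : ∀ x ∈ Ω, m x ^ 2 = μ x)
    (hE : ∀ x ∈ Ω, VDiffAt E x) (hH : ∀ x ∈ Ω, VDiffAt H x) :
    (∀ x ∈ Ω,
        divg (fun y k => ε y * E y k) x = ρ x ∧
        divg (fun y k => μ y * H y k) x = 0 ∧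
        (∀ k, rotg H x k = Complex.I * ω * ε x * E x k + j x k) ∧
        (∀ k, rotg E x k = -(Complex.I * ω * μ x * H x k)))
      ↔
    (∀ x ∈ Ω,
        Dq (fun y => vecQ (fun k => s y * E y k)) x
            + vecQ (fun k => s x * E x k) * vecQ (fun k => pd k s x / s x)
          = ((-(Complex.I * (ω * s x * m x)) : ℂ) : Quaternion ℂ)
                * vecQ (fun k => m x * H x k)
              - ((ρ x / s x : ℂ) : Quaternion ℂ) ∧
        Dq (fun y => vecQ (fun k => m y * H y k)) x
            + vecQ (fun k => m x * H x k) * vecQ (fun k => pd k m x / m x)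
          = ((Complex.I * (ω * s x * m x) : ℂ) : Quaternion ℂ)
                * vecQ (fun k => s x * E x k)
              + vecQ (fun k => m x * j x k)) := by
  refine forall₂_congr fun x hx => ?_
  have hsε' : ∀ᶠ y in nhds x, s y ^ 2 = ε y := Filter.mem_of_superset (hΩ.mem_nhds hx) hsε
  have hmμ' : ∀ᶠ y in nhds x, m y ^ 2 = μ y := Filter.mem_of_superset (hΩ.mem_nhds hx) hmμ
  have s0 := hs0 x hx
  have m0 := hm0 x hx
  rw [Dq_vecQ_add_mul_grad s0 (hs x hx) (hE x hx), Dq_vecQ_add_mul_grad m0 (hm x hx) (hH x hx),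
    divg_mul_of_sq_eq hsε' (hs x hx) (hE x hx), divg_mul_of_sq_eq hmμ' (hm x hx) (hH x hx),
    ← hsε x hx, ← hmμ x hx]
  generalize s x * divg E x + 2 * dotC (gradg s x) (E x) = a
  generalize m x * divg H x + 2 * dotC (gradg m x) (H x) = b
  have hρ : s x * a = ρ x ↔ -a = -(ρ x / s x) := by
    rw [neg_inj, eq_div_iff s0, mul_comm]
  have hb : m x * b = 0 ↔ -b = 0 := by simp [m0]
  have hrH (k : Fin 3) : rotg H x k = Complex.I * ω * s x ^ 2 * E x k + j x k ↔
      m x * rotg H x k = Complex.I * (ω * s x * m x) * (s x * E x k) + m x * j x k := by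
    rw [← mul_right_inj' m0]
    ring_nf
  have hrE (k : Fin 3) : rotg E x k = -(Complex.I * ω * m x ^ 2 * H x k) ↔
      s x * rotg E x k = -(Complex.I * (ω * s x * m x)) * (m x * H x k) := by
    rw [← mul_right_inj' s0]
    ring_nf
  rw [hρ, hb]
  have ext_iff (p q : Quaternion ℂ) :
      p = q ↔ p.re = q.re ∧ p.imI = q.imI ∧ p.imJ = q.imJ ∧ p.imK = q.imK :=
    QuaternionAlgebra.ext_iff
  simp only [hrH, hrE, Fin.forall_fin_succ, ext_iff]
  simp [-Quaternion.coe_mul, -Quaternion.coe_neg]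
  tauto
end
end

section
/- Let Ω ⊆ ℝ³ be open, φ : Ω → ℂ twice differentiable and nowhere vanishing, v : Ω → ℂ a scalar function, and let α = (Dφ)/φ = (grad φ)/φ, a pure quaternion-valued function on Ω. Then α satisfies the quaternionic Riccati equation Dα + α² = -v on Ω if and only if φ satisfies the Schrödinger equation -Δφ + vφ = 0 on Ω (here α² denotes the quaternionic square α·α, equal to -|grad φ|²/φ² with complex-bilinear square of the gradient, and Δ is the Laplacian Σₖ ∂ₖ²). -/
noncomputable section

/-- A function on `ℝ³` whose partial derivatives are all differentiable at a point has a
differentiable Fréchet derivative there. -/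
theorem differentiableAt_fderiv_of_pd {φ : (Fin 3 → ℝ) → ℂ} {x : Fin 3 → ℝ}
    (h : ∀ k : Fin 3, DifferentiableAt ℝ (fun y => pd k φ y) x) :
    DifferentiableAt ℝ (fderiv ℝ φ) x := by
  have key : fderiv ℝ φ = fun y => ∑ k : Fin 3,
      ContinuousLinearMap.smulRightL ℝ (Fin 3 → ℝ) ℂ
        (ContinuousLinearMap.proj (R := ℝ) (φ := fun _ : Fin 3 => ℝ) k) (pd k φ y) := by
    funext y
    refine ContinuousLinearMap.ext fun w => ?_
    conv_lhs => rw [pi_eq_sum_univ' w, map_sum]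
    simp [pd]
  rw [key]
  refine DifferentiableAt.fun_sum fun k _ => ?_
  exact (ContinuousLinearMap.differentiableAt _).comp x (h k)

/-- Mixed second partial derivatives commute. -/
theorem pd_comm {φ : (Fin 3 → ℝ) → ℂ} {x : Fin 3 → ℝ}
    (hφ : ∀ᶠ y in nhds x, DifferentiableAt ℝ φ y)
    (h : ∀ k : Fin 3, DifferentiableAt ℝ (fun y => pd k φ y) x) (j k : Fin 3) :
    pd j (fun y => pd k φ y) x = pd k (fun y => pd j φ y) x := by
  have hd := differentiableAt_fderiv_of_pd h
  have hpd : ∀ i l : Fin 3, pd i (fun y => pd l φ y) x =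
      fderiv ℝ (fderiv ℝ φ) x (Pi.single i 1) (Pi.single l 1) := by
    intro i l
    have hl := fderiv_clm_apply hd (differentiableAt_const (Pi.single l (1 : ℝ)))
    simp [pd, hl]
  rw [hpd, hpd]
  exact second_derivative_symmetric_of_eventually
    (hφ.mono fun y hy => hy.hasFDerivAt) hd.hasFDerivAt _ _

/-- Quotient rule for partial derivatives. -/
theorem pd_div {f g : (Fin 3 → ℝ) → ℂ} {x : Fin 3 → ℝ} (k : Fin 3)
    (hf : DifferentiableAt ℝ f x) (hg : DifferentiableAt ℝ g x) (h0 : g x ≠ 0) :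
    pd k (fun y => f y / g y) x = (pd k f x * g x - f x * pd k g x) / g x ^ 2 := by
  simp only [pd]
  have hinv : HasFDerivAt (fun y => (g y)⁻¹) _ x :=
    (hasFDerivAt_inv' (𝕜 := ℝ) h0).comp x hg.hasFDerivAt
  simp only [div_eq_mul_inv (f _)]
  rw [fderiv_fun_mul hf hinv.differentiableAt, hinv.fderiv]
  simp
  field_simp
  ring

/-- The partial derivatives of a constant function vanish. -/
theorem pd_const (k : Fin 3) (c : ℂ) (x : Fin 3 → ℝ) : pd k (fun _ => c) x = 0 := by
  simp [pd]

/-- The Cole–Hopf identity: `α = (grad φ)/φ` satisfies `Dα + α² = -(Δφ)/φ`. -/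
theorem Dq_logDeriv_add_sq {φ : (Fin 3 → ℝ) → ℂ} {x : Fin 3 → ℝ}
    (hφ : ∀ᶠ y in nhds x, DifferentiableAt ℝ φ y)
    (h : ∀ k : Fin 3, DifferentiableAt ℝ (fun y => pd k φ y) x) (h0 : φ x ≠ 0) :
    Dq (fun y => vecQ (fun k => pd k φ y / φ y)) x
        + vecQ (fun k => pd k φ x / φ x) * vecQ (fun k => pd k φ x / φ x)
      = ((-(lap φ x / φ x) : ℂ) : Quaternion ℂ) := by
  have hdiv : ∀ j k : Fin 3, pd j (fun y => pd k φ y / φ y) x =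
      (pd j (fun y => pd k φ y) x * φ x - pd k φ x * pd j φ x) / φ x ^ 2 :=
    fun j k => pd_div j (h k) hφ.self_of_nhds h0
  have h01 := pd_comm hφ h 0 1
  have h02 := pd_comm hφ h 0 2
  have h12 := pd_comm hφ h 1 2
  ext <;>
    simp only [Dq, Quaternion.re_add, Quaternion.imI_add, Quaternion.imJ_add, Quaternion.imK_add,
      Quaternion.re_mul, Quaternion.imI_mul, Quaternion.imJ_mul, Quaternion.imK_mul] <;>
    simp [ pdQ, vecQ, hdiv, pd_const, lap, Fin.sum_univ_three, h01, h02, h12] <;>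
    field_simp <;> ring

/-- For `α = (grad φ)/φ` with `φ` twice differentiable and nowhere vanishing on open `Ω`,
the quaternionic Riccati equation `Dα + α² = -v` holds on `Ω` iff
the Schrödinger equation `-Δφ + vφ = 0` holds on `Ω`. -/
theorem riccati_iff_schrodinger
    (Ω : Set (Fin 3 → ℝ)) (hΩ : IsOpen Ω) (φ v : (Fin 3 → ℝ) → ℂ)
    (hφ : ∀ x ∈ Ω, DifferentiableAt ℝ φ x)
    (hφ' : ∀ k : Fin 3, ∀ x ∈ Ω, DifferentiableAt ℝ (fun y => pd k φ y) x)
    (hφ0 : ∀ x ∈ Ω, φ x ≠ 0) :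
    (∀ x ∈ Ω,
        Dq (fun y => vecQ (fun k => pd k φ y / φ y)) x
            + vecQ (fun k => pd k φ x / φ x) * vecQ (fun k => pd k φ x / φ x)
          = ((-(v x) : ℂ) : Quaternion ℂ))
      ↔ (∀ x ∈ Ω, -lap φ x + v x * φ x = 0) := by
  refine forall₂_congr fun x hx => ?_
  rw [Dq_logDeriv_add_sq ((hΩ.eventually_mem hx).mono hφ) (fun k => hφ' k x hx) (hφ0 x hx),
    Quaternion.coe_inj, neg_inj, div_eq_iff (hφ0 x hx), neg_add_eq_zero]
end
end
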